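/- Let ε > 0 and μ, ν ∈ M be such that A_μ^ν := { θ ∈ B∞(μ, ε) : ν ≤_c θ } is nonempty, and let R* be the call function of the least element of A_μ^ν with respect to convex order. Then for every x ∈ ℝ one of the following holds: (a) there exists y ∈ ℝ such that, with σ = sgn(y − x), R*(x) = R_ν(y) − R_μ(y + εσ) + R_μ(x + εσ); (b) R*(x) = R_μ(x + ε) (the case y = +∞); or (c) R*(x) = lim_{z→−∞}( R_ν(z) − R_μ(z − ε) ) + R_μ(x − ε) (the case y = −∞). -/

import Mathlib

open MeasureTheory Filter Set
open scoped ENNReal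

/-- Call function `R_μ(x) = ∫ (y−x)⁺ μ(dy)`. -/
noncomputable def callFn (μ : Measure ℝ) (x : ℝ) : ℝ := ∫ y, max (y - x) 0 ∂μ

/-- Mean `Eμ = ∫ y μ(dy)`. -/
noncomputable def meanM (μ : Measure ℝ) : ℝ := ∫ y, y ∂μ

/-- Distribution function `F_μ(x) = μ((−∞,x])`. -/
noncomputable def cdfM (μ : Measure ℝ) (x : ℝ) : ℝ := (μ (Set.Iic x)).toReal

/-- Membership in `M`: Borel probability measure on ℝ with finite first moment. -/
def MemM (μ : Measure ℝ) : Prop :=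
  IsProbabilityMeasure μ ∧ Integrable (fun y => y) μ

/-- Convex order `μ ≤_c ν`. -/
def ConvexOrder (μ ν : Measure ℝ) : Prop :=
  ∀ φ : ℝ → ℝ, ConvexOn ℝ Set.univ φ → Integrable φ μ → Integrable φ ν →
    ∫ y, φ y ∂μ ≤ ∫ y, φ y ∂ν

/-- Infinity Wasserstein distance via distribution functions, valued in `[0,∞]`,
with `inf ∅ = ∞`. -/
noncomputable def Winf (μ ν : Measure ℝ) : ℝ≥0∞ :=
  sInf (ENNReal.ofReal '' {ε : ℝ | 0 < ε ∧ ∀ x : ℝ,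
    cdfM μ (x - ε) ≤ cdfM ν x ∧ cdfM ν x ≤ cdfM μ (x + ε)})

/-- Membership in the closed ball `B^∞(μ,ε)` (within `M`). -/
def InBallWinf (μ : Measure ℝ) (ε : ℝ) (ν : Measure ℝ) : Prop :=
  MemM ν ∧ Winf μ ν ≤ ENNReal.ofReal ε

/-- `conv2 f g`: the largest convex function majorized by `min f g`, pointwise. -/
noncomputable def conv2 (f g : ℝ → ℝ) (x : ℝ) : ℝ :=
  sSup {z : ℝ | ∃ h : ℝ → ℝ, ConvexOn ℝ Set.univ h ∧ (∀ y, h y ≤ min (f y) (g y)) ∧ z = h x}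

/-- `R^min_μ(x; m, ε)`. -/
noncomputable def RminW (μ : Measure ℝ) (m ε x : ℝ) : ℝ :=
  max (m + callFn μ (x - ε) - (meanM μ + ε)) (callFn μ (x + ε))

/-- `R^max_μ(x; m, ε)`. -/
noncomputable def RmaxW (μ : Measure ℝ) (m ε x : ℝ) : ℝ :=
  conv2 (fun y => m + callFn μ (y + ε) - (meanM μ - ε)) (fun y => callFn μ (y - ε)) x

/-- Right derivative. -/
noncomputable def rderiv (f : ℝ → ℝ) (x : ℝ) : ℝ := derivWithin f (Set.Ioi x) x

/-- `R` is a call function: convex, nonincreasing, tending to `0` at `+∞`, and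
`R(x)+x` has a finite limit at `−∞`. -/
def IsCallFn (R : ℝ → ℝ) : Prop :=
  ConvexOn ℝ Set.univ R ∧ Antitone R ∧
    Tendsto R atTop (nhds 0) ∧ ∃ c : ℝ, Tendsto (fun x => R x + x) atBot (nhds c)

/-- Stop-loss distance, valued in `[0,∞]`. -/
noncomputable def dSL (μ ν : Measure ℝ) : ℝ≥0∞ :=
  ⨆ x : ℝ, ENNReal.ofReal |callFn μ x - callFn ν x|

/-- Lévy distance. -/
noncomputable def dLevy (μ ν : Measure ℝ) : ℝ≥0∞ :=
  sInf (ENNReal.ofReal '' {h : ℝ | 0 < h ∧ ∀ x : ℝ,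
    cdfM μ (x - h) - h ≤ cdfM ν x ∧ cdfM ν x ≤ cdfM μ (x + h) + h})

/-- Prokhorov distance on ℝ. -/
noncomputable def dProk (μ ν : Measure ℝ) : ℝ≥0∞ :=
  sInf (ENNReal.ofReal '' {h : ℝ | 0 < h ∧ ∀ A : Set ℝ, IsClosed A →
    ν A ≤ μ (Metric.cthickening h A) + ENNReal.ofReal h})

/-- Modified Lévy distance with parameter `p`. -/
noncomputable def dLevyMod (p : ℝ) (μ ν : Measure ℝ) : ℝ≥0∞ :=
  sInf (ENNReal.ofReal '' {h : ℝ | 0 < h ∧ ∀ x : ℝ,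
    cdfM μ (x - h) - p ≤ cdfM ν x ∧ cdfM ν x ≤ cdfM μ (x + h) + p})

/-- Modified Prokhorov distance with parameter `p`. -/
noncomputable def dProkMod (p : ℝ) (μ ν : Measure ℝ) : ℝ≥0∞ :=
  sInf (ENNReal.ofReal '' {h : ℝ | 0 < h ∧ ∀ A : Set ℝ, IsClosed A →
    ν A ≤ μ (Metric.cthickening h A) + ENNReal.ofReal p})

lemma memM_integrable_call {μ : Measure ℝ} (hμ : MemM μ) (x : ℝ) :
    Integrable (fun y => max (y - x) 0) μ := by
  have := hμ.1
  exact (hμ.2.sub (integrable_const x)).pos_part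

lemma callFn_convex {μ : Measure ℝ} (hμ : MemM μ) : ConvexOn ℝ univ (callFn μ) := by
  have := hμ.1
  refine ⟨convex_univ, ?_⟩
  intro a _ b _ s t hs ht hst
  simp only [smul_eq_mul, callFn]
  rw [← integral_const_mul, ← integral_const_mul, ← integral_add
    ((memM_integrable_call hμ a).const_mul s) ((memM_integrable_call hμ b).const_mul t)]
  apply integral_mono (memM_integrable_call hμ _)
    (((memM_integrable_call hμ a).const_mul s).add ((memM_integrable_call hμ b).const_mul t))
  intro y
  simp only [Pi.add_apply]
  apply max_le
  · have h1 := mul_le_mul_of_nonneg_left (le_max_left (y - a) 0) hs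
    have h2 := mul_le_mul_of_nonneg_left (le_max_left (y - b) 0) ht
    have : y = s * y + t * y := by rw [← add_mul, hst, one_mul]
    linarith
  · have h1 := mul_nonneg hs (le_max_right (y - a) 0)
    have h2 := mul_nonneg ht (le_max_right (y - b) 0)
    linarith

lemma convex_cont {f : ℝ → ℝ} (hf : ConvexOn ℝ univ f) : Continuous f := by
  have := hf.continuousOn isOpen_univ
  exact continuousOn_univ.mp this

lemma callFn_cont {μ : Measure ℝ} (hμ : MemM μ) : Continuous (callFn μ) :=
  convex_cont (callFn_convex hμ)

lemma callFn_nonneg (μ : Measure ℝ) (x : ℝ) : 0 ≤ callFn μ x :=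
  integral_nonneg fun _ => le_max_right _ _

lemma cdfM_eq_one_sub {μ : Measure ℝ} (hμ : MemM μ) (a : ℝ) :
    1 - cdfM μ a = ∫ y, (Ioi a).indicator (fun _ => (1:ℝ)) y ∂μ := by
  have := hμ.1
  rw [integral_indicator measurableSet_Ioi]
  simp only [integral_const, smul_eq_mul, mul_one, measureReal_restrict_apply_univ]
  rw [← compl_Iic, probReal_compl_eq_one_sub measurableSet_Iic]
  rfl

lemma callFn_sub_le {μ : Measure ℝ} (hμ : MemM μ) {a b : ℝ} (hab : a ≤ b) :
    callFn μ a - callFn μ b ≤ (b - a) * (1 - cdfM μ a) := by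
  have := hμ.1
  rw [cdfM_eq_one_sub hμ, callFn, callFn, ← integral_const_mul,
    ← integral_sub (memM_integrable_call hμ _) (memM_integrable_call hμ _)]
  apply integral_mono ((memM_integrable_call hμ _).sub (memM_integrable_call hμ _))
    (((integrable_const _).indicator measurableSet_Ioi).const_mul _)
  intro y
  by_cases h : a < y
  · simp only [Pi.sub_apply, indicator, mem_Ioi, h, if_true]
    rw [max_eq_left (by linarith)]
    linarith [le_max_left (y - b) 0]
  · simp only [Pi.sub_apply, indicator, mem_Ioi, h, if_false]
    rw [max_eq_right (by linarith), max_eq_right (by linarith)]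
    simp

lemma le_callFn_sub {μ : Measure ℝ} (hμ : MemM μ) {a b : ℝ} (hab : a ≤ b) :
    (b - a) * (1 - cdfM μ b) ≤ callFn μ a - callFn μ b := by
  have := hμ.1
  rw [cdfM_eq_one_sub hμ, callFn, callFn, ← integral_const_mul,
    ← integral_sub (memM_integrable_call hμ _) (memM_integrable_call hμ _)]
  apply integral_mono (((integrable_const _).indicator measurableSet_Ioi).const_mul _)
    ((memM_integrable_call hμ _).sub (memM_integrable_call hμ _))
  intro y
  by_cases h : b < y
  · simp only [Pi.sub_apply, indicator, mem_Ioi, h, if_true]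
    rw [max_eq_left (by linarith), max_eq_left (by linarith)]
    linarith
  · simp only [Pi.sub_apply, indicator, mem_Ioi, h, if_false]
    rw [max_eq_right (by linarith : y - b ≤ 0)]
    simp

lemma cdfM_mono {μ : Measure ℝ} (hμ : MemM μ) : Monotone (cdfM μ) := by
  have := hμ.1
  intro a b hab
  exact measureReal_mono (Iic_subset_Iic.mpr hab)

lemma cdfM_eq_cdf {μ : Measure ℝ} (hμ : MemM μ) (x : ℝ) : cdfM μ x = ProbabilityTheory.cdf μ x := by
  have := hμ.1
  rw [ProbabilityTheory.cdf_eq_real]; rfl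

lemma callFn_hasDeriv {μ : Measure ℝ} (hμ : MemM μ) (x : ℝ) :
    HasDerivWithinAt (callFn μ) (cdfM μ x - 1) (Ioi x) x := by
  have := hμ.1
  rw [hasDerivWithinAt_iff_tendsto_slope' self_notMem_Ioi]
  have hc : Tendsto (fun y => cdfM μ y - 1) (nhdsWithin x (Ioi x)) (nhds (cdfM μ x - 1)) := by
    have h := ((ProbabilityTheory.cdf μ).right_continuous x).mono Ioi_subset_Ici_self
    have h2 : Tendsto (fun y => ProbabilityTheory.cdf μ y - 1) (nhdsWithin x (Ioi x))
      (nhds (ProbabilityTheory.cdf μ x - 1)) := Tendsto.sub_const h 1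
    simpa only [cdfM_eq_cdf hμ] using h2
  refine tendsto_of_tendsto_of_tendsto_of_le_of_le' tendsto_const_nhds hc ?_ ?_
  · filter_upwards [self_mem_nhdsWithin] with y hy
    have hy : x < y := hy
    rw [slope_def_field, le_div_iff₀ (by linarith)]
    have := callFn_sub_le hμ hy.le
    linarith
  · filter_upwards [self_mem_nhdsWithin] with y hy
    have hy : x < y := hy
    rw [slope_def_field, div_le_iff₀ (by linarith)]
    have := le_callFn_sub hμ hy.le
    linarith

lemma callFn_tendsto_atTop {μ : Measure ℝ} (hμ : MemM μ) :
    Tendsto (callFn μ) atTop (nhds 0) := by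
  have := tendsto_integral_filter_of_dominated_convergence (μ := μ) (l := atTop)
    (F := fun x y => max (y - x) 0) (f := fun _ => (0:ℝ)) (fun y => |y|)
    (Eventually.of_forall fun x => (memM_integrable_call hμ x).aestronglyMeasurable) ?_
    hμ.2.abs ?_
  · rw [integral_zero] at this; exact this
  · filter_upwards [eventually_ge_atTop 0] with x hx
    refine Eventually.of_forall fun y => ?_
    rw [Real.norm_eq_abs, abs_of_nonneg (le_max_right _ _)]
    exact max_le (by linarith [le_abs_self y]) (abs_nonneg y)
  · refine Eventually.of_forall fun y => ?_
    apply tendsto_const_nhds.congr'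
    filter_upwards [eventually_ge_atTop y] with x hx
    rw [max_eq_right (by linarith)]

lemma callFn_add_eq {μ : Measure ℝ} (hμ : MemM μ) (x : ℝ) :
    callFn μ x + x = ∫ y, max y x ∂μ := by
  have := hμ.1
  have : ∫ _ : ℝ, x ∂μ = x := by simp
  conv_lhs => rw [← this]
  rw [callFn, this]
  conv_lhs => enter [2]; rw [← this]
  rw [← integral_add (memM_integrable_call hμ x) (integrable_const x)]
  congr 1; ext y
  rw [← max_add_add_right]; simp

lemma callFn_tendsto_atBot {μ : Measure ℝ} (hμ : MemM μ) :
    Tendsto (fun x => callFn μ x + x) atBot (nhds (meanM μ)) := by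
  have := hμ.1
  simp_rw [callFn_add_eq hμ]
  refine tendsto_integral_filter_of_dominated_convergence (μ := μ) (l := atBot)
    (F := fun x y => max y x) (f := fun y => y) (fun y => |y|)
    (Eventually.of_forall fun x => (hμ.2.sup (integrable_const x)).aestronglyMeasurable) ?_
    hμ.2.abs ?_
  · filter_upwards [eventually_le_atBot 0] with x hx
    refine Eventually.of_forall fun y => ?_
    rw [Real.norm_eq_abs]
    rcases le_total x y with h | h
    · rw [max_eq_left h]
    · rw [max_eq_right h, abs_of_nonpos hx, abs_of_nonpos (by linarith)]; linarith
  · refine Eventually.of_forall fun y => ?_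
    apply tendsto_const_nhds.congr'
    filter_upwards [eventually_le_atBot y] with x hx
    rw [max_eq_left hx]

/-- A continuous function with nonpositive right derivative is antitone. -/
lemma antitone_of_rderiv {f f' : ℝ → ℝ} (hf : Continuous f)
    (hd : ∀ x, HasDerivWithinAt f (f' x) (Ioi x) x) (h : ∀ x, f' x ≤ 0) : Antitone f := by
  intro a b hab
  exact image_le_of_deriv_right_le_deriv_boundary (f' := f') (B := fun _ => f a)
    (B' := fun _ => 0) hf.continuousOn (fun x _ => (hd x).Ici_of_Ioi) le_rfl continuousOn_const
    (fun x _ => hasDerivWithinAt_const _ _ _) (fun x _ => h x) ⟨hab, le_rfl⟩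

lemma hasDeriv_shift {f : ℝ → ℝ} {c x d : ℝ} (h : HasDerivWithinAt f c (Ioi (x + d)) (x + d)) :
    HasDerivWithinAt (fun y => f (y + d)) c (Ioi x) x := by
  have := HasDerivWithinAt.scomp x (s := Ioi x) (h := fun y => y + d) (h' := 1) (g₁ := f) h
    ((hasDerivWithinAt_id x _).add_const d) (fun y hy => by simpa using hy)
  rw [one_smul] at this
  exact this

lemma callFn_antitone_sub {μ S : Measure ℝ} (hμ : MemM μ) (hS : MemM S) {d : ℝ}
    (h : ∀ x, cdfM S x ≤ cdfM μ (x + d)) :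
    Antitone (fun x => callFn S x - callFn μ (x + d)) := by
  refine antitone_of_rderiv (f' := fun x => (cdfM S x - 1) - (cdfM μ (x + d) - 1)) ?_ ?_ ?_
  · exact (callFn_cont hS).sub ((callFn_cont hμ).comp (continuous_id.add continuous_const))
  · intro x
    exact (callFn_hasDeriv hS x).sub (hasDeriv_shift (callFn_hasDeriv hμ (x + d)))
  · intro x; linarith [h x]

lemma callFn_monotone_sub {μ S : Measure ℝ} (hμ : MemM μ) (hS : MemM S) {d : ℝ}
    (h : ∀ x, cdfM μ (x + d) ≤ cdfM S x) :
    Antitone (fun x => callFn μ (x + d) - callFn S x) := by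
  refine antitone_of_rderiv (f' := fun x => (cdfM μ (x + d) - 1) - (cdfM S x - 1)) ?_ ?_ ?_
  · exact ((callFn_cont hμ).comp (continuous_id.add continuous_const)).sub (callFn_cont hS)
  · intro x
    exact (hasDeriv_shift (callFn_hasDeriv hμ (x + d))).sub (callFn_hasDeriv hS x)
  · intro x; linarith [h x]

lemma ball_cdf {μ S : Measure ℝ} (hμ : MemM μ) {ε d : ℝ} (hε : 0 < ε)
    (hS : InBallWinf μ ε S) (hd : ε < d) (x : ℝ) :
    cdfM μ (x - d) ≤ cdfM S x ∧ cdfM S x ≤ cdfM μ (x + d) := by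
  have h1 : Winf μ S < ENNReal.ofReal d :=
    lt_of_le_of_lt hS.2 ((ENNReal.ofReal_lt_ofReal_iff (hε.trans hd)).mpr hd)
  obtain ⟨_, ⟨e, ⟨he, hx⟩, rfl⟩, hlt⟩ := sInf_lt_iff.mp h1
  rw [ENNReal.ofReal_lt_ofReal_iff (hε.trans hd)] at hlt
  exact ⟨(cdfM_mono hμ (by linarith)).trans (hx x).1, (hx x).2.trans (cdfM_mono hμ (by linarith))⟩

lemma ball_antitone {μ S : Measure ℝ} (hμ : MemM μ) {ε : ℝ} (hε : 0 < ε)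
    (hS : InBallWinf μ ε S) :
    Antitone (fun x => callFn S x - callFn μ (x + ε)) := by
  intro a b hab
  have hc := callFn_cont hμ
  have key : ∀ᶠ d in nhdsWithin ε (Ioi ε),
      callFn S b - callFn μ (b + d) ≤ callFn S a - callFn μ (a + d) := by
    filter_upwards [self_mem_nhdsWithin] with d hd
    exact callFn_antitone_sub hμ hS.1 (fun x => (ball_cdf hμ hε hS hd x).2) hab
  refine le_of_tendsto_of_tendsto (b := nhdsWithin ε (Ioi ε)) ?_ ?_ key
  · exact ((by fun_prop : Continuous fun d => callFn S b - callFn μ (b + d)).tendsto ε).mono_left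
      nhdsWithin_le_nhds
  · exact ((by fun_prop : Continuous fun d => callFn S a - callFn μ (a + d)).tendsto ε).mono_left
      nhdsWithin_le_nhds

lemma ball_monotone {μ S : Measure ℝ} (hμ : MemM μ) {ε : ℝ} (hε : 0 < ε)
    (hS : InBallWinf μ ε S) :
    Antitone (fun x => callFn μ (x - ε) - callFn S x) := by
  intro a b hab
  have hc := callFn_cont hμ
  have key : ∀ᶠ d in nhdsWithin ε (Ioi ε),
      callFn μ (b - d) - callFn S b ≤ callFn μ (a - d) - callFn S a := by
    filter_upwards [self_mem_nhdsWithin] with d hd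
    have := callFn_monotone_sub hμ hS.1 (d := -d)
      (fun x => by simpa [← sub_eq_add_neg] using (ball_cdf hμ hε hS hd x).1) hab
    simpa [← sub_eq_add_neg] using this
  refine le_of_tendsto_of_tendsto (b := nhdsWithin ε (Ioi ε)) ?_ ?_ key
  · exact ((by fun_prop : Continuous fun d => callFn μ (b - d) - callFn S b).tendsto ε).mono_left
      nhdsWithin_le_nhds
  · exact ((by fun_prop : Continuous fun d => callFn μ (a - d) - callFn S a).tendsto ε).mono_left
      nhdsWithin_le_nhds

lemma convex_hasRderiv {φ : ℝ → ℝ} (h : ConvexOn ℝ univ φ) (x : ℝ) :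
    HasDerivWithinAt φ (rderiv φ x) (Ioi x) x :=
  h.hasDerivWithinAt_rightDeriv_of_mem_interior (by simp)

lemma rderiv_mono {φ : ℝ → ℝ} (h : ConvexOn ℝ univ φ) : Monotone (rderiv φ) := by
  have := h.monotoneOn_rightDeriv
  rw [interior_univ] at this
  exact fun a b hab => this (mem_univ a) (mem_univ b) hab

lemma rderiv_le_slope {φ : ℝ → ℝ} (h : ConvexOn ℝ univ φ) {x y : ℝ} (hxy : x < y) :
    rderiv φ x ≤ slope φ x y :=
  h.rightDeriv_le_slope_of_mem_interior (by simp) (mem_univ y) hxy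

lemma rderiv_rcont {φ : ℝ → ℝ} (h : ConvexOn ℝ univ φ) (x : ℝ) :
    ContinuousWithinAt (rderiv φ) (Ici x) x := by
  have hm := rderiv_mono h
  have hc := convex_cont h
  refine tendsto_order.2 ⟨fun c hlt => ?_, fun c hgt => ?_⟩
  · filter_upwards [self_mem_nhdsWithin] with z hz
    exact hlt.trans_le (hm hz)
  · have h1 := (hasDerivWithinAt_iff_tendsto_slope' self_notMem_Ioi).mp (convex_hasRderiv h x)
    obtain ⟨y, hy, hxy⟩ := ((h1.eventually (gt_mem_nhds hgt)).and self_mem_nhdsWithin).exists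
    have hxy : x < y := hxy
    have h2 : ContinuousAt (fun z => slope φ z y) x := by
      simp only [slope_def_field]
      exact ContinuousAt.div (by fun_prop) (by fun_prop) (by linarith)
    have h3 : ∀ᶠ z in nhds x, slope φ z y < c := h2.eventually (gt_mem_nhds hy)
    have h4 : ∀ᶠ z in nhds x, z < y := gt_mem_nhds hxy
    filter_upwards [nhdsWithin_le_nhds h3, nhdsWithin_le_nhds h4] with z hz hzy
    exact (rderiv_le_slope h hzy).trans_lt hz

/-- The Stieltjes function given by the right derivative of a convex function. -/
noncomputable def convSt (φ : ℝ → ℝ) (h : ConvexOn ℝ univ φ) : StieltjesFunction ℝ where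
  toFun := rderiv φ
  mono' := rderiv_mono h
  right_continuous' := rderiv_rcont h

lemma convSt_apply (φ : ℝ → ℝ) (h : ConvexOn ℝ univ φ) (x : ℝ) : convSt φ h x = rderiv φ x := rfl

lemma convex_ftc {φ : ℝ → ℝ} (h : ConvexOn ℝ univ φ) (a b : ℝ) :
    ∫ s in a..b, rderiv φ s = φ b - φ a :=
  intervalIntegral.integral_eq_sub_of_hasDeriv_right (convex_cont h).continuousOn
    (fun x _ => convex_hasRderiv h x) (rderiv_mono h).intervalIntegrable

/-- Kernel of calls and puts. -/
noncomputable def kerCP (y t : ℝ) : ℝ := if 0 < t then max (y - t) 0 else max (t - y) 0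

lemma kerCP_nonneg (y t : ℝ) : 0 ≤ kerCP y t := by
  unfold kerCP; split_ifs <;> exact le_max_right _ _

lemma kerCP_meas : Measurable (fun p : ℝ × ℝ => kerCP p.1 p.2) := by
  unfold kerCP
  refine Measurable.ite ?_ (by fun_prop) (by fun_prop)
  exact measurableSet_lt measurable_const measurable_snd

lemma lint_aux {g : ℝ → ℝ} (hg : ∀ s, IntervalIntegrable g volume 0 s) {c : ℝ} (hc : 0 ≤ c)
    (h1 : ∀ s, s ≤ c → 0 ≤ g s) (h2 : ∀ s, c < s → g s ≤ 0) :
    ∫⁻ s in Ioi 0, ENNReal.ofReal (g s) = ENNReal.ofReal (∫ s in (0:ℝ)..c, g s) := by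
  have e : Ioi (0:ℝ) = Ioc 0 c ∪ Ioi c := (Ioc_union_Ioi_eq_Ioi hc).symm
  rw [e, lintegral_union measurableSet_Ioi (by
    rw [Set.disjoint_left]; intro x hx hx2; exact absurd hx.2 (not_le.mpr hx2))]
  have z : ∫⁻ s in Ioi c, ENNReal.ofReal (g s) = 0 := by
    rw [setLIntegral_congr_fun (g := fun _ => 0) measurableSet_Ioi
      (fun s hs => ENNReal.ofReal_of_nonpos (h2 s hs))]
    simp
  rw [z, add_zero, intervalIntegral.integral_of_le hc]
  rw [ofReal_integral_eq_lintegral_ofReal]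
  · exact ((hg c).1)
  · filter_upwards [ae_restrict_mem measurableSet_Ioc] with s hs
    exact h1 s hs.2

lemma kerCP_rep {φ : ℝ → ℝ} (h : ConvexOn ℝ univ φ) (y : ℝ) :
    ∫⁻ t, ENNReal.ofReal (kerCP y t) ∂(convSt φ h).measure
      = ENNReal.ofReal (φ y - φ 0 - rderiv φ 0 * y) := by
  have hm := rderiv_mono h
  have hmeas : Measurable (kerCP y) := kerCP_meas.comp (measurable_const.prodMk measurable_id)
  rcases le_total 0 y with hy | hy
  · rw [lintegral_eq_lintegral_meas_le _ (Eventually.of_forall (kerCP_nonneg y)) hmeas.aemeasurable]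
    have e : ∀ s ∈ Ioi (0:ℝ), (convSt φ h).measure {a | s ≤ kerCP y a}
        = ENNReal.ofReal (rderiv φ (y - s) - rderiv φ 0) := by
      intro s hs
      have hs : 0 < s := hs
      rw [← convSt_apply φ h, ← convSt_apply φ h, ← StieltjesFunction.measure_Ioc]
      congr 1
      ext t
      simp only [mem_ofPred_eq, mem_Ioc, kerCP]
      split_ifs with ht
      · rw [le_max_iff]
        constructor
        · rintro (h | h)
          · exact ⟨ht, by linarith⟩
          · linarith
        · rintro ⟨_, h⟩; left; linarith
      · rw [le_max_iff]
        constructor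
        · rintro (h | h) <;> linarith
        · rintro ⟨h, _⟩; exact absurd h ht
    rw [setLIntegral_congr_fun measurableSet_Ioi e]
    have hi : ∀ a b, IntervalIntegrable (fun s => rderiv φ (y - s)) volume a b := by
      intro a b
      exact Antitone.intervalIntegrable (fun u v huv => hm (by linarith))
    rw [lint_aux (c := y) (fun s => (hi 0 s).sub intervalIntegrable_const) hy]
    · congr 1
      rw [intervalIntegral.integral_sub (hi _ _) intervalIntegrable_const,
        intervalIntegral.integral_comp_sub_left (fun s => rderiv φ s) y]
      rw [convex_ftc h]
      simp
      ring
    · intro s hs; linarith [hm (show 0 ≤ y - s by linarith)]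
    · intro s hs; linarith [hm (show y - s ≤ 0 by linarith)]
  · rw [lintegral_eq_lintegral_meas_lt _ (Eventually.of_forall (kerCP_nonneg y)) hmeas.aemeasurable]
    have e : ∀ s ∈ Ioi (0:ℝ), (convSt φ h).measure {a | s < kerCP y a}
        = ENNReal.ofReal (rderiv φ 0 - rderiv φ (y + s)) := by
      intro s hs
      have hs : 0 < s := hs
      rw [← convSt_apply φ h, ← convSt_apply φ h, ← StieltjesFunction.measure_Ioc]
      congr 1
      ext t
      simp only [mem_ofPred_eq, mem_Ioc, kerCP]
      split_ifs with ht
      · rw [lt_max_iff]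
        constructor
        · rintro (h | h) <;> linarith
        · rintro ⟨_, h⟩; linarith
      · rw [lt_max_iff]
        constructor
        · rintro (h | h)
          · exact ⟨by linarith, by linarith⟩
          · linarith
        · rintro ⟨h, _⟩; left; linarith
    rw [setLIntegral_congr_fun measurableSet_Ioi e]
    have hi : ∀ a b, IntervalIntegrable (fun s => rderiv φ (y + s)) volume a b := by
      intro a b
      exact Monotone.intervalIntegrable (fun u v huv => hm (by linarith))
    rw [lint_aux (c := -y) (fun s => intervalIntegrable_const.sub (hi 0 s)) (by linarith)]
    · congr 1
      rw [intervalIntegral.integral_sub intervalIntegrable_const (hi _ _),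
        intervalIntegral.integral_comp_add_left (fun s => rderiv φ s) y]
      rw [convex_ftc h]
      simp
      ring
    · intro s hs; linarith [hm (show y + s ≤ 0 by linarith)]
    · intro s hs; linarith [hm (show 0 ≤ y + s by linarith)]

lemma put_integral {μ : Measure ℝ} (hμ : MemM μ) (t : ℝ) :
    Integrable (fun y => max (t - y) 0) μ ∧
    ∫ y, max (t - y) 0 ∂μ = callFn μ t + t - meanM μ := by
  have := hμ.1
  have e : (fun y => max (t - y) 0) = fun y => max (y - t) 0 + t - y := by
    ext y
    rcases le_total t y with h | h
    · rw [max_eq_right (by linarith), max_eq_left (by linarith)]; ring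
    · rw [max_eq_left (by linarith), max_eq_right (by linarith)]; ring
  have i1 := memM_integrable_call hμ t
  rw [e]
  refine ⟨(i1.add (integrable_const t)).sub hμ.2, ?_⟩
  have i2 : Integrable (fun y => max (y - t) 0 + t) μ := i1.add (integrable_const t)
  rw [integral_sub i2 hμ.2, integral_add i1 (integrable_const t)]
  simp [callFn, meanM]

lemma lint_kerCP {μ : Measure ℝ} (hμ : MemM μ) (t : ℝ) :
    ∫⁻ y, ENNReal.ofReal (kerCP y t) ∂μ =
      ENNReal.ofReal (if 0 < t then callFn μ t else callFn μ t + t - meanM μ) := by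
  by_cases ht : 0 < t
  · simp only [kerCP, ht, if_true]
    rw [callFn, ofReal_integral_eq_lintegral_ofReal (memM_integrable_call hμ t)
      (Eventually.of_forall fun _ => le_max_right _ _)]
  · simp only [kerCP, ht, if_false]
    rw [← (put_integral hμ t).2, ofReal_integral_eq_lintegral_ofReal (put_integral hμ t).1
      (Eventually.of_forall fun _ => le_max_right _ _)]

lemma lint_convex {μ : Measure ℝ} (hμ : MemM μ) {φ : ℝ → ℝ} (h : ConvexOn ℝ univ φ) :
    ∫⁻ y, ENNReal.ofReal (φ y - φ 0 - rderiv φ 0 * y) ∂μ =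
      ∫⁻ t, ENNReal.ofReal (if 0 < t then callFn μ t else callFn μ t + t - meanM μ)
        ∂(convSt φ h).measure := by
  have := hμ.1
  simp_rw [← kerCP_rep h, ← lint_kerCP hμ]
  exact lintegral_lintegral_swap (ENNReal.measurable_ofReal.comp kerCP_meas).aemeasurable

lemma convexOrder_of_call {ν θ : Measure ℝ} (hν : MemM ν) (hθ : MemM θ)
    (hm : meanM ν = meanM θ) (hc : ∀ x, callFn ν x ≤ callFn θ x) : ConvexOrder ν θ := by
  intro φ h h1 h2
  have := hν.1
  have := hθ.1
  have hnn : ∀ y, 0 ≤ φ y - φ 0 - rderiv φ 0 * y := by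
    intro y
    have hmo := rderiv_mono h
    have e := convex_ftc h 0 y
    rcases le_total 0 y with hy | hy
    · have := intervalIntegral.integral_mono_on hy (intervalIntegrable_const (c := rderiv φ 0))
        (hmo.intervalIntegrable (μ := volume)) (fun x hx => hmo hx.1)
      rw [e] at this
      simp at this
      linarith
    · have := intervalIntegral.integral_mono_on hy (hmo.intervalIntegrable (μ := volume))
        (intervalIntegrable_const (c := rderiv φ 0)) (fun x hx => hmo hx.2)
      rw [convex_ftc h y 0] at this
      simp at this
      linarith
  have key : ∀ {τ : Measure ℝ}, MemM τ → Integrable φ τ →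
      Integrable (fun y => φ y - φ 0 - rderiv φ 0 * y) τ ∧
      ∫ y, (φ y - φ 0 - rderiv φ 0 * y) ∂τ = ∫ y, φ y ∂τ - φ 0 - rderiv φ 0 * meanM τ := by
    intro τ hτ hi
    have := hτ.1
    refine ⟨(hi.sub (integrable_const _)).sub (hτ.2.const_mul _), ?_⟩
    have i2 : Integrable (fun y => φ y - φ 0) τ := hi.sub (integrable_const _)
    rw [integral_sub i2 (hτ.2.const_mul _),
      integral_sub hi (integrable_const _), integral_const_mul]
    simp [meanM]
  have k1 := key hν h1
  have k2 := key hθ h2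
  have le : ∫ y, (φ y - φ 0 - rderiv φ 0 * y) ∂ν ≤ ∫ y, (φ y - φ 0 - rderiv φ 0 * y) ∂θ := by
    rw [← ENNReal.ofReal_le_ofReal_iff (integral_nonneg hnn),
      ofReal_integral_eq_lintegral_ofReal k1.1 (Eventually.of_forall hnn),
      ofReal_integral_eq_lintegral_ofReal k2.1 (Eventually.of_forall hnn),
      lint_convex hν h, lint_convex hθ h]
    apply lintegral_mono
    intro t
    apply ENNReal.ofReal_le_ofReal
    rw [hm]
    split_ifs
    · exact hc t
    · linarith [hc t]
  rw [k1.2, k2.2, hm] at le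
  linarith

lemma rderiv_nonpos_of_antitone {f : ℝ → ℝ} (hf : Antitone f) {d x : ℝ}
    (hd : HasDerivWithinAt f d (Ioi x) x) : d ≤ 0 := by
  refine le_of_tendsto ((hasDerivWithinAt_iff_tendsto_slope' self_notMem_Ioi).mp hd) ?_
  filter_upwards [self_mem_nhdsWithin] with y hy
  have hy : x < y := hy
  rw [slope_def_field]
  exact div_nonpos_of_nonpos_of_nonneg (by linarith [hf hy.le]) (by linarith)

lemma integrable_of_cdf {μ θ : Measure ℝ} (hμ : MemM μ) [IsProbabilityMeasure θ] {ε : ℝ}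
    (hε : 0 < ε) (h : ∀ x, cdfM μ (x - ε) ≤ cdfM θ x ∧ cdfM θ x ≤ cdfM μ (x + ε)) :
    Integrable (fun y => y) θ := by
  have := hμ.1
  have hi : Integrable (fun y => |y| + ε) μ := hμ.2.abs.add (integrable_const _)
  have fin : ∫⁻ y, ENNReal.ofReal (|y| + ε) ∂μ < ⊤ := hi.lintegral_lt_top
  refine ⟨measurable_id.aestronglyMeasurable, ?_⟩
  rw [hasFiniteIntegral_iff_norm]
  simp only [Real.norm_eq_abs]
  refine lt_of_le_of_lt ?_ (ENNReal.mul_lt_top (by simp : (2:ℝ≥0∞) < ⊤) fin)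
  rw [lintegral_eq_lintegral_meas_lt θ (Eventually.of_forall fun y => abs_nonneg y)
    (by fun_prop), lintegral_eq_lintegral_meas_le μ
    (Eventually.of_forall fun y => by positivity) (by fun_prop),
    ← lintegral_const_mul' _ _ (by simp)]
  apply lintegral_mono
  intro s
  have up : ∀ x, θ (Iic x) ≤ μ (Iic (x + ε)) := fun x =>
    (ENNReal.toReal_le_toReal (measure_ne_top _ _) (measure_ne_top _ _)).mp (h x).2
  have lo : ∀ x, μ (Iic (x - ε)) ≤ θ (Iic x) := fun x =>
    (ENNReal.toReal_le_toReal (measure_ne_top _ _) (measure_ne_top _ _)).mp (h x).1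
  have sub : {a : ℝ | s < |a|} ⊆ Ioi s ∪ Iic (-s) := by
    intro a ha
    have ha : s < |a| := ha
    rcases lt_abs.mp ha with h | h
    · left; exact h
    · right; simp only [mem_Iic]; linarith
  calc θ {a | s < |a|} ≤ θ (Ioi s ∪ Iic (-s)) := measure_mono sub
    _ ≤ θ (Ioi s) + θ (Iic (-s)) := measure_union_le _ _
    _ ≤ μ (Ioi (s - ε)) + μ (Iic (-s + ε)) := by
        gcongr ?_ + ?_
        · rw [← compl_Iic, ← compl_Iic, prob_compl_eq_one_sub measurableSet_Iic,
            prob_compl_eq_one_sub measurableSet_Iic]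
          exact tsub_le_tsub_left (lo s) 1
        · exact up _
    _ ≤ μ {a | s ≤ |a| + ε} + μ {a | s ≤ |a| + ε} := by
        gcongr
        · intro a ha
          have : s - ε < a := ha
          show s ≤ |a| + ε
          linarith [le_abs_self a]
        · intro a ha
          have : a ≤ -s + ε := ha
          show s ≤ |a| + ε
          linarith [neg_le_abs a]
    _ = 2 * μ {a | s ≤ |a| + ε} := (two_mul _).symm

lemma cdfM_tendsto_atTop {μ : Measure ℝ} (hμ : MemM μ) : Tendsto (cdfM μ) atTop (nhds 1) := by
  have := hμ.1
  have h := ProbabilityTheory.tendsto_cdf_atTop μ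
  exact h.congr (fun x => (cdfM_eq_cdf hμ x).symm)

lemma cdfM_tendsto_atBot {μ : Measure ℝ} (hμ : MemM μ) : Tendsto (cdfM μ) atBot (nhds 0) := by
  have := hμ.1
  have h := ProbabilityTheory.tendsto_cdf_atBot μ
  exact h.congr (fun x => (cdfM_eq_cdf hμ x).symm)

lemma theta_exists {μ : Measure ℝ} (hμ : MemM μ) {ε : ℝ} (hε : 0 < ε) {T : ℝ → ℝ}
    (hT : ConvexOn ℝ univ T) (h1 : Antitone (fun x => T x - callFn μ (x + ε)))
    (h2 : Antitone (fun x => callFn μ (x - ε) - T x)) (h0 : Tendsto T atTop (nhds 0)) :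
    ∃ θ : Measure ℝ, InBallWinf μ ε θ ∧ ∀ x, callFn θ x = T x := by
  have up : ∀ x, rderiv T x + 1 ≤ cdfM μ (x + ε) := by
    intro x
    have := rderiv_nonpos_of_antitone h1
      ((convex_hasRderiv hT x).sub (hasDeriv_shift (callFn_hasDeriv hμ (x + ε))))
    linarith
  have lo : ∀ x, cdfM μ (x - ε) ≤ rderiv T x + 1 := by
    intro x
    have := rderiv_nonpos_of_antitone h2 (d := (cdfM μ (x - ε) - 1) - rderiv T x) (x := x) (by
      have h3 := (hasDeriv_shift (d := -ε) (x := x) (callFn_hasDeriv hμ (x + -ε))).sub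
        (convex_hasRderiv hT x)
      simp only [← sub_eq_add_neg] at h3
      exact h3)
    linarith
  let F : StieltjesFunction ℝ := convSt T hT + StieltjesFunction.const ℝ 1
  have hF : ∀ x, F x = rderiv T x + 1 := fun x => rfl
  have top : Tendsto F atTop (nhds 1) := by
    refine tendsto_of_tendsto_of_tendsto_of_le_of_le
      ((cdfM_tendsto_atTop hμ).comp (tendsto_atTop_add_const_right _ (-ε) tendsto_id))
      ((cdfM_tendsto_atTop hμ).comp (tendsto_atTop_add_const_right _ ε tendsto_id))
      (fun x => ?_) (fun x => ?_)
    · simpa [hF, ← sub_eq_add_neg] using lo x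
    · simpa [hF] using up x
  have bot : Tendsto F atBot (nhds 0) := by
    refine tendsto_of_tendsto_of_tendsto_of_le_of_le
      ((cdfM_tendsto_atBot hμ).comp (tendsto_atBot_add_const_right _ (-ε) tendsto_id))
      ((cdfM_tendsto_atBot hμ).comp (tendsto_atBot_add_const_right _ ε tendsto_id))
      (fun x => ?_) (fun x => ?_)
    · simpa [hF, ← sub_eq_add_neg] using lo x
    · simpa [hF] using up x
  have hprob : IsProbabilityMeasure F.measure := F.isProbabilityMeasure bot top
  have hcdf : ∀ x, cdfM F.measure x = rderiv T x + 1 := by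
    intro x
    rw [cdfM, F.measure_Iic bot, sub_zero, hF, ENNReal.toReal_ofReal]
    exact le_trans ENNReal.toReal_nonneg (lo x)
  have hball : ∀ x, cdfM μ (x - ε) ≤ cdfM F.measure x ∧ cdfM F.measure x ≤ cdfM μ (x + ε) :=
    fun x => by rw [hcdf]; exact ⟨lo x, up x⟩
  have hM : MemM F.measure := ⟨hprob, integrable_of_cdf hμ hε hball⟩
  refine ⟨F.measure, ⟨hM, sInf_le ⟨ε, ⟨hε, hball⟩, rfl⟩⟩, ?_⟩
  have hc1 := callFn_cont hM
  have hc2 := convex_cont hT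
  have a1 : Antitone (fun x => callFn F.measure x - T x) :=
    antitone_of_rderiv (f' := fun _ => 0) (hc1.sub hc2) (fun x => by
      have := (callFn_hasDeriv hM x).sub (convex_hasRderiv hT x)
      rw [hcdf] at this
      have e : rderiv T x + 1 - 1 - rderiv T x = 0 := by ring
      rw [e] at this
      exact this) (fun _ => le_rfl)
  have a2 : Antitone (fun x => T x - callFn F.measure x) :=
    antitone_of_rderiv (f' := fun _ => 0) (hc2.sub hc1) (fun x => by
      have := (convex_hasRderiv hT x).sub (callFn_hasDeriv hM x)
      rw [hcdf] at this
      have e : rderiv T x - (rderiv T x + 1 - 1) = 0 := by ring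
      rw [e] at this
      exact this) (fun _ => le_rfl)
  intro x
  have lim : Tendsto (fun x => callFn F.measure x - T x) atTop (nhds (0 - 0)) :=
    (callFn_tendsto_atTop hM).sub h0
  have lim2 : Tendsto (fun x => callFn F.measure x - T x) atTop
      (nhds (callFn F.measure x - T x)) := by
    apply tendsto_const_nhds.congr'
    filter_upwards [eventually_ge_atTop x] with y hy
    have b1 := a1 hy
    have b2 := a2 hy
    simp only at b1 b2
    linarith
  have := tendsto_nhds_unique lim lim2
  linarith

/-- The function inside the supremum. -/
noncomputable def Gfun (r R : ℝ → ℝ) (ε x y : ℝ) : ℝ :=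
  r y + min (R (x + ε) - R (y + ε)) (R (x - ε) - R (y - ε))

lemma conv_affine {f : ℝ → ℝ} (hf : ConvexOn ℝ univ f) {c m p q z : ℝ} (hp : f p ≤ c + m * p)
    (hq : f q ≤ c + m * q) (h1 : p ≤ z) (h2 : z ≤ q) : f z ≤ c + m * z := by
  obtain ⟨u, w, hu, hw, huw, rfl⟩ := Icc_subset_segment (𝕜 := ℝ) ⟨h1, h2⟩
  have h := hf.2 (mem_univ p) (mem_univ q) hu hw huw
  simp only [smul_eq_mul] at h ⊢
  have e1 := mul_le_mul_of_nonneg_left hp hu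
  have e2 := mul_le_mul_of_nonneg_left hq hw
  have : c = u * c + w * c := by rw [← add_mul, huw, one_mul]
  nlinarith

lemma conv_shift {f : ℝ → ℝ} (hf : ConvexOn ℝ univ f) (d k : ℝ) :
    ConvexOn ℝ univ (fun x => f (x + d) + k) := by
  have h1 : ConvexOn ℝ univ (fun x => f (x + d)) := by
    have := hf.translate_left d
    simpa [Function.comp_def] using this
  exact h1.add_const k

lemma Gfun_sup_convex {r R : ℝ → ℝ} {ε : ℝ} (hr : ConvexOn ℝ univ r) (hR : ConvexOn ℝ univ R)
    (hD : Antitone (fun x => R (x - ε) - R (x + ε)))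
    (hb : ∀ x, BddAbove (range (Gfun r R ε x))) :
    ConvexOn ℝ univ (fun x => ⨆ y, Gfun r R ε x y) := by
  have le : ∀ x y, Gfun r R ε x y ≤ ⨆ y, Gfun r R ε x y := fun x y => le_ciSup (hb x) y
  have ler : ∀ x, r x ≤ ⨆ y, Gfun r R ε x y := by
    intro x
    have := le x x
    simpa [Gfun] using this
  generalize hT : (fun x => ⨆ y, Gfun r R ε x y) = T
  have eT : ∀ x, (⨆ y, Gfun r R ε x y) = T x := fun x => by rw [← hT]
  simp only [eT] at le ler
  apply LinearOrder.convexOn_of_lt convex_univ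
  intro a _ b _ hab s t hs ht hst
  simp only [smul_eq_mul]
  set x := s * a + t * b with hx
  have hs' : s = 1 - t := by linarith
  have hax : a ≤ x := by rw [hx, hs']; nlinarith
  have hxb : x ≤ b := by rw [hx, hs']; nlinarith
  obtain ⟨c, m, hca, hcb⟩ : ∃ c m : ℝ, c + m * a = T a ∧ c + m * b = T b := by
    have hne : b - a ≠ 0 := by linarith
    refine ⟨T a - (T b - T a) / (b - a) * a, (T b - T a) / (b - a), by ring, ?_⟩
    field_simp; ring
  have goal_eq : s * T a + t * T b = c + m * x := by
    rw [← hca, ← hcb, hx, hs']; ring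
  rw [goal_eq, ← eT]
  apply ciSup_le
  intro y
  have g1 : ∀ z, z ≤ y → r y + (R (z + ε) - R (y + ε)) ≤ T z := by
    intro z hz
    have := hD hz
    simp only at this
    have h := le z y
    rwa [Gfun, min_eq_left (by linarith)] at h
  have g2 : ∀ z, y ≤ z → r y + (R (z - ε) - R (y - ε)) ≤ T z := by
    intro z hz
    have := hD hz
    simp only at this
    have h := le z y
    rwa [Gfun, min_eq_right (by linarith)] at h
  have u1 : Gfun r R ε x y ≤ R (x + ε) + (r y - R (y + ε)) := by
    unfold Gfun; linarith [min_le_left (R (x + ε) - R (y + ε)) (R (x - ε) - R (y - ε))]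
  have u2 : Gfun r R ε x y ≤ R (x + -ε) + (r y - R (y - ε)) := by
    rw [← sub_eq_add_neg]
    unfold Gfun; linarith [min_le_right (R (x + ε) - R (y + ε)) (R (x - ε) - R (y - ε))]
  have c1 := conv_shift hR ε (r y - R (y + ε))
  have c2 := conv_shift hR (-ε) (r y - R (y - ε))
  rcases le_or_gt y x with hyx | hxy
  · refine u2.trans ?_
    have hB : R (b + -ε) + (r y - R (y - ε)) ≤ c + m * b := by
      rw [hcb, ← sub_eq_add_neg]; linarith [g2 b (by linarith)]
    rcases le_or_gt y a with hya | hay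
    · have hA : R (a + -ε) + (r y - R (y - ε)) ≤ c + m * a := by
        rw [hca, ← sub_eq_add_neg]; linarith [g2 a hya]
      exact conv_affine c2 hA hB hax hxb
    · have hry : r y ≤ c + m * y :=
        conv_affine hr (p := a) (q := b) (by linarith [ler a]) (by linarith [ler b]) hay.le (by linarith)
      have hA : R (y + -ε) + (r y - R (y - ε)) ≤ c + m * y := by
        rw [← sub_eq_add_neg]; linarith
      exact conv_affine c2 hA hB hyx hxb
  · refine u1.trans ?_
    have hA : R (a + ε) + (r y - R (y + ε)) ≤ c + m * a := by
      rw [hca]; linarith [g1 a (by linarith)]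
    rcases le_or_gt b y with hby | hyb
    · have hB : R (b + ε) + (r y - R (y + ε)) ≤ c + m * b := by
        rw [hcb]; linarith [g1 b hby]
      exact conv_affine c1 hA hB hax hxb
    · have hry : r y ≤ c + m * y :=
        conv_affine hr (p := a) (q := b) (by linarith [ler a]) (by linarith [ler b]) (by linarith) hyb.le
      have hB : R (y + ε) + (r y - R (y + ε)) ≤ c + m * y := by linarith
      exact conv_affine c1 hA hB hax hxy.le

lemma callFn_D_antitone {μ : Measure ℝ} (hμ : MemM μ) {ε : ℝ} (hε : 0 < ε) :
    Antitone (fun x => callFn μ (x - ε) - callFn μ (x + ε)) := by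
  have hc := callFn_cont hμ
  refine antitone_of_rderiv
    (f' := fun x => (cdfM μ (x + -ε) - 1) - (cdfM μ (x + ε) - 1)) (by fun_prop) ?_ ?_
  · intro x
    have h3 := (hasDeriv_shift (d := -ε) (x := x) (callFn_hasDeriv hμ (x + -ε))).sub
      (hasDeriv_shift (callFn_hasDeriv hμ (x + ε)))
    simp only [← sub_eq_add_neg] at h3 ⊢
    exact h3
  · intro x
    linarith [cdfM_mono hμ (show x + -ε ≤ x + ε by linarith)]

/-- representation of `R* = R_{S_ν(μ)}`: for every `x`, either
(a) `R*(x) = R_ν(y) − R_μ(y+εσ) + R_μ(x+εσ)` for some real `y` with `σ = sgn(y−x)`,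
(b) `R*(x) = R_μ(x+ε)` (case `y = +∞`), or
(c) `R*(x) = lim_{z→−∞}(R_ν(z) − R_μ(z−ε)) + R_μ(x−ε)` (case `y = −∞`). -/
theorem representation_of_Rstar (ε : ℝ) (hε : 0 < ε) (μ ν : Measure ℝ)
    (hμ : MemM μ) (hν : MemM ν) (S : Measure ℝ)
    (hS : (InBallWinf μ ε S ∧ ConvexOrder ν S) ∧
      (∀ θ : Measure ℝ, InBallWinf μ ε θ → ConvexOrder ν θ → ConvexOrder S θ)) :
    ∀ x : ℝ,
      (∃ y : ℝ, callFn S x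
          = callFn ν y - callFn μ (y + ε * Real.sign (y - x))
            + callFn μ (x + ε * Real.sign (y - x))) ∨
      callFn S x = callFn μ (x + ε) ∨
      (∃ L : ℝ, Tendsto (fun z => callFn ν z - callFn μ (z - ε)) atBot (nhds L) ∧
        callFn S x = L + callFn μ (x - ε)) := by
  obtain ⟨⟨hB, hνS⟩, hmin⟩ := hS
  have hSM : MemM S := hB.1
  have order_call : ∀ {α β : Measure ℝ}, MemM α → MemM β → ConvexOrder α β →
      ∀ x, callFn α x ≤ callFn β x := by
    intro α β hα hβ h x
    refine h (fun y => max (y - x) 0) ?_ (memM_integrable_call hα x) (memM_integrable_call hβ x)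
    have h1 : ConvexOn ℝ univ (fun y : ℝ => y - x) := by
      have := (convexOn_id (𝕜 := ℝ) (convex_univ (E := ℝ))).add_const (-x)
      simp only [sub_eq_add_neg]
      exact this
    exact h1.sup (convexOn_const 0 convex_univ)
  have hr : ∀ x, callFn ν x ≤ callFn S x := order_call hν hSM hνS
  have hmean : meanM ν = meanM S := by
    apply le_antisymm
    · exact hνS (fun y => y) (convexOn_id convex_univ) hν.2 hSM.2
    · have := hνS (fun y => -y) (concaveOn_id convex_univ).neg hν.2.neg hSM.2.neg
      rw [integral_neg, integral_neg] at this
      exact neg_le_neg_iff.mp this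
  have b1 := ball_antitone hμ hε hB
  have b2 := ball_monotone hμ hε hB
  have hD := callFn_D_antitone hμ hε
  have hGC : ∀ x y, Gfun (callFn ν) (callFn μ) ε x y ≤ callFn S x := by
    intro x y
    unfold Gfun
    rcases le_total x y with h | h
    · have := b1 h
      simp only at this
      linarith [min_le_left (callFn μ (x + ε) - callFn μ (y + ε))
        (callFn μ (x - ε) - callFn μ (y - ε)), hr y]
    · have := b2 h
      simp only at this
      linarith [min_le_right (callFn μ (x + ε) - callFn μ (y + ε))
        (callFn μ (x - ε) - callFn μ (y - ε)), hr y]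
  have hbdd : ∀ x, BddAbove (range (Gfun (callFn ν) (callFn μ) ε x)) := by
    intro x
    refine ⟨callFn S x, ?_⟩
    rintro _ ⟨y, rfl⟩
    exact hGC x y
  have hTconv := Gfun_sup_convex (callFn_convex hν) (callFn_convex hμ) hD hbdd
  have hTle : ∀ x, (⨆ y, Gfun (callFn ν) (callFn μ) ε x y) ≤ callFn S x :=
    fun x => ciSup_le (hGC x)
  have hrT : ∀ x, callFn ν x ≤ ⨆ y, Gfun (callFn ν) (callFn μ) ε x y := by
    intro x
    have h := le_ciSup (hbdd x) x
    have e : Gfun (callFn ν) (callFn μ) ε x x = callFn ν x := by simp [Gfun]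
    rw [e] at h
    exact h
  have t1 : Antitone (fun x => (⨆ y, Gfun (callFn ν) (callFn μ) ε x y) - callFn μ (x + ε)) := by
    intro a b hab
    have h3 := hD hab
    simp only at h3 ⊢
    rw [sub_le_iff_le_add]
    apply ciSup_le
    intro y
    have h4 := le_ciSup (hbdd a) y
    unfold Gfun at h4 ⊢
    rcases min_choice (callFn μ (a + ε) - callFn μ (y + ε))
      (callFn μ (a - ε) - callFn μ (y - ε)) with h | h
    · linarith [min_le_left (callFn μ (b + ε) - callFn μ (y + ε))
        (callFn μ (b - ε) - callFn μ (y - ε))]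
    · linarith [min_le_right (callFn μ (b + ε) - callFn μ (y + ε))
        (callFn μ (b - ε) - callFn μ (y - ε))]
  have t2 : Antitone (fun x => callFn μ (x - ε) - (⨆ y, Gfun (callFn ν) (callFn μ) ε x y)) := by
    intro a b hab
    have h3 := hD hab
    simp only at h3 ⊢
    suffices h : (⨆ y, Gfun (callFn ν) (callFn μ) ε a y) ≤
        (⨆ y, Gfun (callFn ν) (callFn μ) ε b y) + callFn μ (a - ε) - callFn μ (b - ε) by linarith
    apply ciSup_le
    intro y
    have h4 := le_ciSup (hbdd b) y
    unfold Gfun at h4 ⊢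
    rcases min_choice (callFn μ (b + ε) - callFn μ (y + ε))
      (callFn μ (b - ε) - callFn μ (y - ε)) with h | h
    · linarith [min_le_left (callFn μ (a + ε) - callFn μ (y + ε))
        (callFn μ (a - ε) - callFn μ (y - ε))]
    · linarith [min_le_right (callFn μ (a + ε) - callFn μ (y + ε))
        (callFn μ (a - ε) - callFn μ (y - ε))]
  have t0 : Tendsto (fun x => ⨆ y, Gfun (callFn ν) (callFn μ) ε x y) atTop (nhds 0) :=
    tendsto_of_tendsto_of_tendsto_of_le_of_le (callFn_tendsto_atTop hν)
      (callFn_tendsto_atTop hSM) hrT hTle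
  obtain ⟨θ, hθB, hθ⟩ := theta_exists hμ hε hTconv t1 t2 t0
  have hmθ : meanM ν = meanM θ := by
    refine tendsto_nhds_unique (f := fun x => callFn θ x + x) (l := atBot) ?_
      (callFn_tendsto_atBot hθB.1)
    refine tendsto_of_tendsto_of_tendsto_of_le_of_le (callFn_tendsto_atBot hν)
      (hmean ▸ callFn_tendsto_atBot hSM) (fun x => ?_) (fun x => ?_)
    · have := hrT x
      rw [← hθ] at this
      simpa using this
    · have := hTle x
      rw [← hθ] at this
      simpa using this
  have hνθ : ConvexOrder ν θ :=
    convexOrder_of_call hν hθB.1 hmθ (fun x => by rw [hθ]; exact hrT x)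
  have hSθ := order_call hSM hθB.1 (hmin θ hθB hνθ)
  have hSeq : ∀ x, callFn S x = ⨆ y, Gfun (callFn ν) (callFn μ) ε x y := fun x =>
    le_antisymm (by rw [← hθ]; exact hSθ x) (hTle x)
  intro x
  have hcμ := callFn_cont hμ
  have hcν := callFn_cont hν
  have hcont : Continuous (Gfun (callFn ν) (callFn μ) ε x) := by
    unfold Gfun; fun_prop
  have gtop : ∀ y, x ≤ y → Gfun (callFn ν) (callFn μ) ε x y
      = callFn ν y - callFn μ (y + ε) + callFn μ (x + ε) := by
    intro y hy
    have := hD hy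
    simp only at this
    rw [Gfun, min_eq_left (by linarith)]; ring
  have gbot : ∀ y, y ≤ x → Gfun (callFn ν) (callFn μ) ε x y
      = callFn ν y - callFn μ (y - ε) + callFn μ (x - ε) := by
    intro y hy
    have := hD hy
    simp only at this
    rw [Gfun, min_eq_right (by linarith)]; ring
  have ltop : Tendsto (Gfun (callFn ν) (callFn μ) ε x) atTop (nhds (callFn μ (x + ε))) := by
    have h1 : Tendsto (fun y => callFn ν y - callFn μ (y + ε) + callFn μ (x + ε)) atTop
        (nhds (0 - 0 + callFn μ (x + ε))) :=
      ((callFn_tendsto_atTop hν).sub ((callFn_tendsto_atTop hμ).comp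
        (tendsto_atTop_add_const_right _ ε tendsto_id))).add_const _
    rw [sub_zero, zero_add] at h1
    apply h1.congr'
    filter_upwards [eventually_ge_atTop x] with y hy
    exact (gtop y hy).symm
  have hL : Tendsto (fun z => callFn ν z - callFn μ (z - ε)) atBot
      (nhds (meanM ν - meanM μ - ε)) := by
    have h1 := ((callFn_tendsto_atBot hν).sub ((callFn_tendsto_atBot hμ).comp
        (tendsto_atBot_add_const_right _ (-ε) tendsto_id))).sub_const ε
    apply h1.congr
    intro z
    simp only [Function.comp, id, ← sub_eq_add_neg]
    ring
  have lbot : Tendsto (Gfun (callFn ν) (callFn μ) ε x) atBot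
      (nhds (meanM ν - meanM μ - ε + callFn μ (x - ε))) := by
    apply (hL.add_const (callFn μ (x - ε))).congr'
    filter_upwards [eventually_le_atBot x] with y hy
    exact (gbot y hy).symm
  by_cases hb : callFn S x = callFn μ (x + ε)
  · exact Or.inr (Or.inl hb)
  by_cases hc : callFn S x = meanM ν - meanM μ - ε + callFn μ (x - ε)
  · exact Or.inr (Or.inr ⟨_, hL, hc⟩)
  left
  have l1 : callFn μ (x + ε) < callFn S x :=
    lt_of_le_of_ne (le_of_tendsto ltop (Eventually.of_forall (hGC x))) (Ne.symm hb)
  have l2 : meanM ν - meanM μ - ε + callFn μ (x - ε) < callFn S x :=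
    lt_of_le_of_ne (le_of_tendsto lbot (Eventually.of_forall (hGC x))) (Ne.symm hc)
  have l3 := max_lt l1 l2
  rw [hSeq] at l3
  obtain ⟨y0, hy0⟩ := exists_lt_of_lt_ciSup l3
  obtain ⟨hy1, hy2⟩ := max_lt_iff.mp hy0
  have hev : ∀ᶠ y in cocompact ℝ, Gfun (callFn ν) (callFn μ) ε x y
      ≤ Gfun (callFn ν) (callFn μ) ε x y0 := by
    rw [cocompact_eq_atBot_atTop, eventually_sup]
    exact ⟨(lbot.eventually (gt_mem_nhds hy2)).mono fun _ h => h.le,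
      (ltop.eventually (gt_mem_nhds hy1)).mono fun _ h => h.le⟩
  obtain ⟨y, hy⟩ := hcont.exists_forall_ge' y0 hev
  have hfin : callFn S x = Gfun (callFn ν) (callFn μ) ε x y := by
    rw [hSeq]
    exact le_antisymm (ciSup_le hy) (le_ciSup (hbdd x) y)
  refine ⟨y, ?_⟩
  rw [hfin]
  rcases lt_trichotomy y x with h | h | h
  · rw [Real.sign_of_neg (by linarith), gbot y h.le]
    simp [sub_eq_add_neg]
  · subst h
    simp [Gfun]
  · rw [Real.sign_of_pos (by linarith), gtop y h.le]
    simp
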